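/- Let f(z) = z + Σ_{n≥2} a_n z^n be analytic on the unit disk and belong to R^τ(A,B), i.e., |(f'(z)−1)/((A−B)τ − B(f'(z)−1))| < 1 for all |z| < 1, where τ ∈ ℂ\{0}, −1 ≤ B < A ≤ 1. Then |a_n| ≤ (A−B)|τ|/n for all n ≥ 2. -/

import Mathlib

open Filter Topology Asymptotics Metric

lemma convex_setOf_norm_lt_norm_sub_mul (c : ℂ) {B : ℝ} (hB : |B| ≤ 1) :
    Convex ℝ {p : ℂ | ‖p‖ < ‖c - B * p‖} := by
  have hB2 : 0 ≤ 1 - B ^ 2 := by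
    have := (sq_le_one_iff_abs_le_one B).2 hB
    linarith
  have key : ∀ p : ℂ, ‖p‖ < ‖c - B * p‖ ↔
      (1 - B ^ 2) * (p.re ^ 2 + p.im ^ 2) + 2 * B * (c.re * p.re + c.im * p.im) <
        c.re ^ 2 + c.im ^ 2 := by
    intro p
    rw [← sq_lt_sq₀ (norm_nonneg _) (norm_nonneg _), Complex.sq_norm, Complex.sq_norm,
      Complex.normSq_apply, Complex.normSq_apply]
    simp only [Complex.sub_re, Complex.sub_im, Complex.re_ofReal_mul, Complex.im_ofReal_mul]
    constructor <;> intro h <;> nlinarith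
  intro x hx y hy s t hs ht hst
  simp only [Set.mem_ofPred_eq, key] at hx hy ⊢
  simp only [Complex.add_re, Complex.add_im, Complex.real_smul, Complex.re_ofReal_mul,
    Complex.im_ofReal_mul]
  obtain rfl : t = 1 - s := by linarith
  have h1 : 0 ≤ (1 - B ^ 2) * (s * (1 - s) * ((x.re - y.re) ^ 2 + (x.im - y.im) ^ 2)) := by
    positivity
  rcases hs.eq_or_lt with rfl | hs
  · simpa using hy
  · nlinarith [mul_lt_mul_of_pos_left hx hs, mul_le_mul_of_nonneg_left hy.le ht]

lemma IsPrimitiveRoot.sum_pow_pow_eq_ite {ω : ℂ} {n : ℕ} (hω : IsPrimitiveRoot ω n)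
    (m : ℕ) : ∑ k ∈ Finset.range n, (ω ^ k) ^ m = if n ∣ m then (n : ℂ) else 0 := by
  simp_rw [← pow_mul, mul_comm _ m, pow_mul]
  split_ifs with h
  · simp [hω.pow_eq_one_iff_dvd m |>.2 h]
  · have h1 : ω ^ m ≠ 1 := fun h' => h (hω.pow_eq_one_iff_dvd m |>.1 h')
    rw [geom_sum_eq h1, ← pow_mul, mul_comm, pow_mul, hω.pow_eq_one]
    simp

/-- Averaging over the `n`-th roots of unity keeps the coefficients with index divisible by `n`. -/
lemma HasFPowerSeriesAt.average_rootsOfUnity {P : ℂ → ℂ} {p : ℕ → ℂ}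
    (hp : HasFPowerSeriesAt P (.ofScalars ℂ p) 0) {ω : ℂ} {n : ℕ} (hn : n ≠ 0)
    (hω : IsPrimitiveRoot ω n) :
    HasFPowerSeriesAt (fun z => ∑ k ∈ Finset.range n, (n : ℝ)⁻¹ • P (ω ^ k * z))
      (.ofScalars ℂ fun m => if n ∣ m then p m else 0) 0 := by
  rw [hasFPowerSeriesAt_iff] at hp ⊢
  have h1 : ∀ k ∈ Finset.range n, ∀ᶠ z in 𝓝 (0 : ℂ),
      HasSum (fun m => (ω ^ k * z) ^ m • p m) (P (ω ^ k * z)) := by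
    intro k _
    have : Tendsto (fun z : ℂ => ω ^ k * z) (𝓝 0) (𝓝 0) := by
      simpa using (continuous_const_mul (ω ^ k)).tendsto (0 : ℂ)
    simpa using this.eventually hp
  filter_upwards [(Filter.eventually_all_finset _).2 h1] with z hz
  rw [zero_add]
  convert! hasSum_sum fun k hk => (hz k hk).const_smul ((n : ℝ)⁻¹) using 2 with m
  have hs := hω.sum_pow_pow_eq_ite m
  have hn' : (n : ℂ) ≠ 0 := by exact_mod_cast hn
  have : ∑ k ∈ Finset.range n, (n : ℝ)⁻¹ • ((ω ^ k * z) ^ m • p m) =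
      (n : ℂ)⁻¹ * (z ^ m * p m) * ∑ k ∈ Finset.range n, (ω ^ k) ^ m := by
    rw [Finset.mul_sum]
    refine Finset.sum_congr rfl fun k _ => ?_
    simp only [Complex.real_smul, smul_eq_mul, mul_pow]
    push_cast
    ring
  rw [this, hs]
  simp only [FormalMultilinearSeries.coeff_ofScalars, smul_eq_mul]
  split_ifs
  · field_simp
  · simp

/-- Rogosinski's coefficient bound for functions with values in the convex domain
`{p | ‖p‖ < ‖c - B * p‖}`. -/
theorem norm_coeff_le_of_norm_lt_norm_sub_mul {P : ℂ → ℂ} {p : ℕ → ℂ} {c : ℂ} {B : ℝ}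
    (hB : |B| ≤ 1) (hP : DifferentiableOn ℂ P (ball 0 1))
    (hlt : ∀ z ∈ ball (0 : ℂ) 1, ‖P z‖ < ‖c - B * P z‖)
    (hp : HasFPowerSeriesAt P (.ofScalars ℂ p) 0) (hp0 : p 0 = 0) {n : ℕ} (hn : n ≠ 0) :
    ‖p n‖ ≤ ‖c‖ := by
  have hω := Complex.isPrimitiveRoot_exp n hn
  set ω := Complex.exp (2 * Real.pi * Complex.I / n)
  set G : ℂ → ℂ := fun z => ∑ k ∈ Finset.range n, (n : ℝ)⁻¹ • P (ω ^ k * z) with hGdef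
  have hG := hp.average_rootsOfUnity hn hω
  rw [← hGdef] at hG
  have hmaps : ∀ k, Set.MapsTo (fun z => ω ^ k * z) (ball 0 1) (ball 0 1) := by
    intro k z hz
    simpa [hω.norm'_eq_one hn] using hz
  have hGd : DifferentiableOn ℂ G (ball 0 1) := by
    refine DifferentiableOn.fun_sum fun k _ => ?_
    exact (hP.comp (by fun_prop) (hmaps k)).const_smul ((n : ℝ)⁻¹)
  have hGlt : ∀ z ∈ ball (0 : ℂ) 1, ‖G z‖ < ‖c - B * G z‖ := by
    intro z hz
    refine (convex_setOf_norm_lt_norm_sub_mul c hB).sum_mem (fun _ _ => by positivity) ?_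
      (fun k _ => hlt _ (hmaps k hz))
    simp [hn]
  have hne : ∀ z ∈ ball (0 : ℂ) 1, c - B * G z ≠ 0 := fun z hz =>
    norm_pos_iff.1 ((norm_nonneg _).trans_lt (hGlt z hz))
  have hG0 : G 0 = 0 := by
    have h := hG.coeff_zero 0
    rw [← h]
    simp [hp0]
  have hpart : ∀ z, (FormalMultilinearSeries.ofScalars ℂ
      fun m => if n ∣ m then p m else 0).partialSum n z = 0 := by
    intro z
    refine Finset.sum_eq_zero fun m hm => ?_
    rw [FormalMultilinearSeries.ofScalars_apply_eq]
    rcases eq_or_ne m 0 with rfl | h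
    · simp [hp0]
    · have : ¬ n ∣ m := fun hd =>
        (Nat.le_of_dvd (Nat.pos_of_ne_zero h) hd).not_gt (Finset.mem_range.1 hm)
      simp [this]
  have hGO : G =O[𝓝 0] fun z => ‖z‖ ^ n := by
    simpa [hpart] using hG.isBigO_sub_partialSum_pow n
  have hGo : (fun z => G z - p n * z ^ n) =o[𝓝 0] fun z => z ^ n := by
    have h := hG.isBigO_sub_partialSum_pow (n + 1)
    have hsucc : ∀ z, (FormalMultilinearSeries.ofScalars ℂ
        fun m => if n ∣ m then p m else 0).partialSum (n + 1) z = p n * z ^ n := by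
      intro z
      have := hpart z
      rw [FormalMultilinearSeries.partialSum] at this ⊢
      rw [Finset.sum_range_succ, this]
      simp [mul_comm]
    simp only [zero_add, hsucc] at h
    have h2 : (fun z : ℂ => ‖z‖ ^ (n + 1)) =o[𝓝 0] fun z => z ^ n :=
      (isLittleO_pow_pow (𝕜 := ℂ) n.lt_succ_self).norm_left.congr_left fun z => by simp
    exact h.trans_isLittleO h2
  set w : ℂ → ℂ := fun z => G z / (c - B * G z) with hw
  have hwd : DifferentiableOn ℂ w (ball 0 1) := hGd.div (by fun_prop) hne
  have hw0 : w 0 = 0 := by simp [hw, hG0]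
  have hcont : ContinuousAt G 0 := hG.continuousAt
  have hwO : w =O[𝓝 0] fun z => ‖z‖ ^ n := by
    have h1 : (fun z => (c - B * G z)⁻¹) =O[𝓝 0] fun _ => (1 : ℝ) := by
      have : ContinuousAt (fun z => (c - B * G z)⁻¹) 0 :=
        ContinuousAt.inv₀ (by fun_prop) (hne 0 (by simp))
      exact this.tendsto.isBigO_one ℝ
    simpa [hw, div_eq_mul_inv] using hGO.mul h1
  have hwo : (w · - w 0) =o[𝓝 0] fun z => ‖z - 0‖ ^ (n - 1) := by
    have h2 : (fun z : ℂ => ‖z‖ ^ n) =o[𝓝 0] fun z => ‖z‖ ^ (n - 1) :=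
      (isLittleO_pow_pow (𝕜 := ℂ) (by omega : n - 1 < n)).norm_norm.congr
        (fun z => by simp) (fun z => by simp)
    simpa [hw0] using hwO.trans_isLittleO h2
  have hwm : Set.MapsTo w (ball 0 1) (closedBall (w 0) 1) := by
    intro z hz
    rw [hw0, mem_closedBall_zero_iff, hw, norm_div]
    exact div_le_one_of_le₀ (hGlt z hz).le (norm_nonneg _)
  have hbound : ∀ z ∈ ball (0 : ℂ) 1, ‖G z‖ ≤ ‖z‖ ^ n * ‖c - B * G z‖ := by
    intro z hz
    have h := Complex.dist_le_mul_div_pow_of_mapsTo_ball_of_isLittleO hwd hwm hwo hz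
    rw [Nat.sub_add_cancel (Nat.pos_of_ne_zero hn)] at h
    rw [hw0, dist_zero_right, dist_zero_right, div_one, one_mul, hw, norm_div] at h
    rwa [div_le_iff₀ (norm_pos_iff.2 (hne z hz))] at h
  have hlim1 : Tendsto (fun z => ‖G z / z ^ n‖) (𝓝[≠] 0) (𝓝 ‖p n‖) := by
    have h := (hGo.tendsto_div_nhds_zero.mono_left (nhdsWithin_le_nhds (s := {0}ᶜ))).add_const (p n)
    rw [zero_add] at h
    refine (h.congr' ?_).norm
    filter_upwards [self_mem_nhdsWithin] with z hz
    have : z ^ n ≠ 0 := pow_ne_zero _ hz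
    field_simp
    ring
  have hlim2 : Tendsto (fun z => ‖c - B * G z‖) (𝓝[≠] 0) (𝓝 ‖c‖) := by
    have : ContinuousAt (fun z => ‖c - B * G z‖) 0 := by fun_prop
    simpa [hG0] using this.tendsto.mono_left (nhdsWithin_le_nhds (s := {0}ᶜ))
  refine le_of_tendsto_of_tendsto hlim1 hlim2 ?_
  filter_upwards [self_mem_nhdsWithin, nhdsWithin_le_nhds (ball_mem_nhds (0 : ℂ) one_pos)]
    with z hz hz1
  have : 0 < ‖z ^ n‖ := norm_pos_iff.2 (pow_ne_zero _ hz)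
  rw [norm_div, div_le_iff₀ this, norm_pow, mul_comm]
  exact hbound z hz1

/-- On a connected set, the bound `‖P / (c - B * P)‖ < 1` excludes poles, where the quotient
has the junk value `0`. -/
lemma norm_lt_norm_sub_mul_of_norm_div_lt_one {P : ℂ → ℂ} {c b : ℂ} {s : Set ℂ} {z₀ : ℂ}
    (hs : IsPreconnected s) (hc : c ≠ 0) (hP : ContinuousOn P s) (hz₀ : z₀ ∈ s)
    (hPz₀ : P z₀ = 0) (h : ∀ z ∈ s, ‖P z / (c - b * P z)‖ < 1) :
    ∀ z ∈ s, ‖P z‖ < ‖c - b * P z‖ := by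
  have hcont : ContinuousOn (fun z => ‖c - b * P z‖ - ‖P z‖) s := by fun_prop
  have hne : ∀ z ∈ s, ‖c - b * P z‖ - ‖P z‖ ≠ 0 := by
    intro z hz h0
    have h' := h z hz
    rw [norm_div, sub_eq_zero.1 h0] at h'
    rcases eq_or_ne ‖P z‖ 0 with h1 | h1
    · have h2 : P z = 0 := norm_eq_zero.1 h1
      simp [h2, hc] at h0
    · rw [div_self h1] at h'
      exact h'.false
  intro z hz
  by_contra! hcon
  obtain ⟨y, hy, hy0⟩ := hs.intermediate_value hz hz₀ hcont
    (show (0 : ℝ) ∈ _ by simp [hPz₀, hcon])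
  exact hne y hy hy0


/-- Dixit–Pal coefficient bound: if `f(z) = z + Σ_{n≥2} aₙ zⁿ` is analytic on the unit
disk and `|(f'(z)−1)/((A−B)τ − B(f'(z)−1))| < 1` there, then `|aₙ| ≤ (A−B)|τ|/n`. -/
theorem dixit_pal_coeff_bound (τ : ℂ) (hτ : τ ≠ 0) (A B : ℝ)
    (hB : -1 ≤ B) (hBA : B < A) (hA : A ≤ 1)
    (a : ℕ → ℂ) (f : ℂ → ℂ)
    (hf : ∀ z : ℂ, ‖z‖ < 1 → HasSum (fun n : ℕ => a (n + 2) * z ^ (n + 2)) (f z - z))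
    (hanal : AnalyticOnNhd ℂ f (Metric.ball (0 : ℂ) 1))
    (hR : ∀ z : ℂ, ‖z‖ < 1 →
      ‖(deriv f z - 1) / (((A : ℂ) - B) * τ - B * (deriv f z - 1))‖ < 1) :
    ∀ n : ℕ, 2 ≤ n → ‖a n‖ ≤ (A - B) * ‖τ‖ / n := by
  intro n hn
  let b : ℕ → ℂ := fun m => if m = 0 then 0 else if m = 1 then 1 else a m
  have hb : HasFPowerSeriesAt f (.ofScalars ℂ b) 0 := by
    rw [hasFPowerSeriesAt_iff]
    filter_upwards [ball_mem_nhds (0 : ℂ) one_pos] with z hz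
    rw [← hasSum_nat_add_iff' 2]
    simpa [b, Finset.sum_range_succ, mul_comm] using hf z (by simpa using hz)
  have h0 : (0 : ℂ) ∈ ball (0 : ℂ) 1 := by simp
  have hbm : ∀ m, iteratedDeriv m f 0 / m.factorial = b m := fun m => by
    have := hb.eq_formalMultilinearSeries (hanal 0 h0).hasFPowerSeriesAt
    exact (congrFun (FormalMultilinearSeries.ofScalars_series_injective ℂ ℂ this) m).symm
  have hd1 : deriv f 0 = 1 := by simpa [b] using hbm 1
  set P : ℂ → ℂ := fun z => deriv f z - 1
  have hPan : AnalyticOnNhd ℂ P (ball 0 1) := hanal.deriv.sub analyticOnNhd_const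
  have hc : ((A : ℂ) - B) * τ ≠ 0 :=
    mul_ne_zero (sub_ne_zero.2 (by exact_mod_cast hBA.ne')) hτ
  have hlt := norm_lt_norm_sub_mul_of_norm_div_lt_one (P := P)
    (convex_ball (0 : ℂ) 1).isPreconnected hc hPan.continuousOn h0 (by simp [P, hd1])
    (fun z hz => hR z (by simpa using hz))
  have hmain := norm_coeff_le_of_norm_lt_norm_sub_mul (abs_le.2 ⟨hB, by linarith⟩)
    hPan.differentiableOn hlt (hPan 0 h0).hasFPowerSeriesAt (by simp [P, hd1])
    (n := n - 1) (by omega)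
  obtain ⟨m, rfl⟩ : ∃ m, n = m + 2 := ⟨n - 2, by omega⟩
  have hcoef : iteratedDeriv (m + 1) P 0 / (m + 1).factorial = (m + 2 : ℕ) * a (m + 2) := by
    have h1 : iteratedDeriv (m + 1) P 0 = iteratedDeriv (m + 2) f 0 := by
      rw [iteratedDeriv_succ', iteratedDeriv_succ' (n := m + 1), iteratedDeriv_succ']
      congr 1
      ext z
      simp [P]
    have h2 : iteratedDeriv (m + 2) f 0 / (m + 2).factorial = a (m + 2) := by
      simpa [b] using hbm (m + 2)
    rw [h1, ← h2, Nat.factorial_succ (m + 1)]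
    have h3 : ((m + 1).factorial : ℂ) ≠ 0 := by exact_mod_cast Nat.factorial_ne_zero (m + 1)
    have h4 : ((m + 2 : ℕ) : ℂ) ≠ 0 := by exact_mod_cast (m + 1).succ_ne_zero
    rw [Nat.cast_mul]
    field_simp
  have hnorm : ‖(A : ℂ) - B‖ = A - B := by
    rw [← Complex.ofReal_sub, Complex.norm_real, Real.norm_of_nonneg (by linarith)]
  rw [show m + 2 - 1 = m + 1 from rfl, hcoef, norm_mul, norm_mul, hnorm,
    Complex.norm_natCast] at hmain
  rw [le_div_iff₀ (by positivity)]
  linarith
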